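/- Let x and y be real numbers and let T : ℕ → ℝ be a function such that T(2) = x, and for every integer n ≥ 3 there exist integers n₁, n₂, n₃ ≥ 1 with n₁ + n₂ + n₃ = n and T(n) = y + T(n₁ + 1) + T(n₂ + 1) + T(n₃ + 1). Then for every integer n ≥ 2, T(n) = x·(2n - 3) + y·(n - 2). -/

import Mathlib

theorem stmt_5 (x y : ℝ) (T : ℕ → ℝ)
    (hbase : T 2 = x)
    (hrec : ∀ n : ℕ, 3 ≤ n → ∃ n₁ n₂ n₃ : ℕ,
      1 ≤ n₁ ∧ 1 ≤ n₂ ∧ 1 ≤ n₃ ∧ n₁ + n₂ + n₃ = n ∧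
      T n = y + T (n₁ + 1) + T (n₂ + 1) + T (n₃ + 1)) :
    ∀ n : ℕ, 2 ≤ n → T n = x * (2 * n - 3) + y * (n - 2) := by
  intro n
  induction n using Nat.strong_induction_on with
  | _ n ih =>
    intro hn
    obtain rfl | hn := hn.eq_or_lt
    · rw [hbase]
      push_cast
      ring
    · obtain ⟨a, b, c, ha, hb, hc, rfl, hT⟩ := hrec n hn
      rw [hT, ih (a + 1) (by omega) (by omega), ih (b + 1) (by omega) (by omega),
        ih (c + 1) (by omega) (by omega)]
      push_cast
      ring
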